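/- Let σ be an ALG-schedule and σ_O any schedule of the same instance, and assume 1/(1−α) is an integer. Then at every time t ≥ 0 it holds that |N(t) ∖ O(t)| ≤ (2 + 1/(1−α)) · |O(t)|. -/

import Mathlib

open MeasureTheory Set

open scoped Classical

noncomputable section

variable {J : Type*}

/-- Total work done on job `j` by time `u` under the schedule `σ`. -/
def workDone (σ : ℝ → J → ℝ) (j : J) (u : ℝ) : ℝ := ∫ v in (0:ℝ)..u, σ v j

/-- Remaining processing time of job `j` at time `u`. -/
def remT (p : J → ℝ) (σ : ℝ → J → ℝ) (j : J) (u : ℝ) : ℝ := p j - workDone σ j u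

/-- Completion time of job `j`: the least `u` with `workDone σ j u = p j`,
    and `⊤` if the job never completes. -/
def cTime (p : J → ℝ) (σ : ℝ → J → ℝ) (j : J) : EReal :=
  sInf ((fun v : ℝ => (v : EReal)) '' {v : ℝ | workDone σ j v = p j})

/-- Job `j` is available at time `u`: released and not yet completed. -/
def availAt (r p : J → ℝ) (σ : ℝ → J → ℝ) (u : ℝ) (j : J) : Prop :=
  r j ≤ u ∧ (u : EReal) < cTime p σ j

/-- Job `j` is processed at time `u`. -/
def procAt (σ : ℝ → J → ℝ) (u : ℝ) (j : J) : Prop := 0 < σ u j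

/-- Job `j` is non-clairvoyant at time `u`. -/
def ncAt (r p : J → ℝ) (α : ℝ) (σ : ℝ → J → ℝ) (u : ℝ) (j : J) : Prop :=
  availAt r p σ u j ∧ workDone σ j u ≤ α * p j

/-- Job `j` is clairvoyant at time `u`. -/
def clAt (r p : J → ℝ) (α : ℝ) (σ : ℝ → J → ℝ) (u : ℝ) (j : J) : Prop :=
  availAt r p σ u j ∧ α * p j < workDone σ j u

/-- The time at which job `j` emits its signal: the least `u` with
    `workDone σ j u = α * p j`. -/
def emitT (p : J → ℝ) (α : ℝ) (σ : ℝ → J → ℝ) (j : J) : ℝ :=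
  sInf {u : ℝ | workDone σ j u = α * p j}

/-- Data of an instance: nonnegative release dates, positive processing times
    and `α ∈ (0,1)`. -/
structure IsInstance (r p : J → ℝ) (α : ℝ) : Prop where
  r_nonneg : ∀ j, 0 ≤ r j
  p_pos : ∀ j, 0 < p j
  alpha_mem : α ∈ Set.Ioo (0 : ℝ) 1

/-- `σ` is a (feasible, preemptive, single machine) schedule. -/
structure IsSchedule [Fintype J] (r p : J → ℝ) (σ : ℝ → J → ℝ) : Prop where
  meas : ∀ j, Measurable fun u => σ u j
  nonneg : ∀ u j, 0 ≤ σ u j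
  sum_le_one : ∀ u, ∑ j, σ u j ≤ 1
  zero_before_release : ∀ u j, u < r j → σ u j = 0
  workDone_le : ∀ u j, workDone σ j u ≤ p j

/-- A schedule is non-idling if it uses the full machine capacity whenever
    some job is available. -/
def NonIdling [Fintype J] (r p : J → ℝ) (σ : ℝ → J → ℝ) : Prop :=
  ∀ u, (∃ j, availAt r p σ u j) → ∑ j, σ u j = 1

/-- The SRPT condition at time `u`: `Cl(u) ≠ ∅` and
    `min_{j ∈ Cl(u)} p_j(u) ≤ ((1-α)/α) · min_{j ∈ N(u)} y_j(u)`
    (the minimum over the empty set being `+∞`). -/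
def SrptCond (r p : J → ℝ) (α : ℝ) (σ : ℝ → J → ℝ) (u : ℝ) : Prop :=
  ∃ k, clAt r p α σ u k ∧
    ∀ j, ncAt r p α σ u j → remT p σ k u ≤ ((1 - α) / α) * workDone σ j u

/-- `k` is a clairvoyant job of minimal remaining processing time at `u`,
    emitting last among those. -/
def IsSrptChoice (r p : J → ℝ) (α : ℝ) (σ : ℝ → J → ℝ) (u : ℝ) (k : J) : Prop :=
  clAt r p α σ u k ∧
    (∀ j, clAt r p α σ u j → remT p σ k u ≤ remT p σ j u) ∧
    (∀ j, clAt r p α σ u j → remT p σ j u = remT p σ k u →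
      emitT p α σ j ≤ emitT p α σ k)

/-- `j` is a non-clairvoyant job with minimal progress at time `u`. -/
def IsMinNc (r p : J → ℝ) (α : ℝ) (σ : ℝ → J → ℝ) (u : ℝ) (j : J) : Prop :=
  ncAt r p α σ u j ∧ ∀ j', ncAt r p α σ u j' → workDone σ j u ≤ workDone σ j' u

/-- `σ` is an ALG-schedule: non-idling, and at any time with available jobs it
    either runs a single clairvoyant job of shortest remaining processing time
    (breaking ties by latest emission) when the SRPT condition holds, or it runs
    exactly the non-clairvoyant jobs of minimal progress at equal rates. -/
structure IsALG [Fintype J] (r p : J → ℝ) (α : ℝ) (σ : ℝ → J → ℝ) : Prop where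
  sched : IsSchedule r p σ
  nonidling : NonIdling r p σ
  srpt_branch : ∀ u, (∃ j, availAt r p σ u j) → SrptCond r p α σ u →
    ∃ k, IsSrptChoice r p α σ u k ∧ ∀ j, j ≠ k → σ u j = 0
  setf_branch : ∀ u, (∃ j, availAt r p σ u j) → ¬ SrptCond r p α σ u →
    (∀ j, procAt σ u j → IsMinNc r p α σ u j) ∧
    (∀ j j', IsMinNc r p α σ u j → IsMinNc r p α σ u j' → σ u j = σ u j')

/-- Right endpoint `min (C_j, t)` of the lifetime of `j` w.r.t. reference time `t`. -/
def lifeEnd (p : J → ℝ) (σ : ℝ → J → ℝ) (t : ℝ) (j : J) : ℝ :=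
  (min (cTime p σ j) (t : EReal)).toReal

/-- The lifetime `I_j = [r j, min (C_j, t)]` of job `j`. -/
def lifetime (r p : J → ℝ) (σ : ℝ → J → ℝ) (t : ℝ) (j : J) : Set ℝ :=
  Set.Icc (r j) (lifeEnd p σ t j)

/-- `E_N`-edge of the borrow graph: `i` is processed at some time of `I_j`
    while being non-clairvoyant. -/
def ENedge (r p : J → ℝ) (α : ℝ) (σ : ℝ → J → ℝ) (t : ℝ) (j i : J) : Prop :=
  ∃ u ∈ lifetime r p σ t j, procAt σ u i ∧ ncAt r p α σ u i

/-- `E_C`-edge of the borrow graph: `i` is processed at some time of `I_j`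
    while being clairvoyant. -/
def ECedge (r p : J → ℝ) (α : ℝ) (σ : ℝ → J → ℝ) (t : ℝ) (j i : J) : Prop :=
  ∃ u ∈ lifetime r p σ t j, procAt σ u i ∧ clAt r p α σ u i

/-- Edge of the borrow graph `G_B`. -/
def borrowEdge (r p : J → ℝ) (α : ℝ) (σ : ℝ → J → ℝ) (t : ℝ) (j i : J) : Prop :=
  ENedge r p α σ t j i ∨ ECedge r p α σ t j i

/-- `reaches j i` iff `i ∈ R_j`, i.e. `i` is reachable from `j` in the borrow
    graph (`j` itself included). -/
def reaches (r p : J → ℝ) (α : ℝ) (σ : ℝ → J → ℝ) (t : ℝ) : J → J → Prop :=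
  Relation.ReflTransGen (borrowEdge r p α σ t)

/-- Truncated progress `ȳ_j = min (y_j(t), α p_j)`. -/
def truncY (p : J → ℝ) (α : ℝ) (σ : ℝ → J → ℝ) (t : ℝ) (j : J) : ℝ :=
  min (workDone σ j t) (α * p j)

end

namespace IsSchedule

variable {J : Type*} [Fintype J] {r p : J → ℝ} {σ : ℝ → J → ℝ}

theorem le_one (h : IsSchedule r p σ) (u : ℝ) (j : J) : σ u j ≤ 1 :=
  (Finset.single_le_sum (fun i _ => h.nonneg u i) (Finset.mem_univ j)).trans (h.sum_le_one u)

theorem intervalIntegrable (h : IsSchedule r p σ) (j : J) (a b : ℝ) :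
    IntervalIntegrable (fun u => σ u j) volume a b := by
  refine (intervalIntegrable_const (c := (1 : ℝ))).mono_fun
    (h.meas j).aestronglyMeasurable (Filter.Eventually.of_forall fun u => ?_)
  simpa [abs_of_nonneg (h.nonneg u j)] using h.le_one u j

theorem workDone_sub (h : IsSchedule r p σ) (j : J) (a b : ℝ) :
    workDone σ j b - workDone σ j a = ∫ v in a..b, σ v j :=
  intervalIntegral.integral_interval_sub_left (h.intervalIntegrable j 0 b)
    (h.intervalIntegrable j 0 a)

theorem workDone_mono (h : IsSchedule r p σ) (j : J) : Monotone (workDone σ j) := by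
  intro a b hab
  have h1 := h.workDone_sub j a b
  have h2 : 0 ≤ ∫ v in a..b, σ v j :=
    intervalIntegral.integral_nonneg hab fun u _ => h.nonneg u j
  linarith

theorem workDone_continuous (h : IsSchedule r p σ) (j : J) : Continuous (workDone σ j) :=
  intervalIntegral.continuous_primitive (fun a b => h.intervalIntegrable j a b) 0

theorem workDone_eq_zero (hr : ∀ j, 0 ≤ r j) (h : IsSchedule r p σ) {j : J} {u : ℝ}
    (hu : u ≤ r j) : workDone σ j u = 0 := by
  refine intervalIntegral.integral_zero_ae ?_
  have hne : ∀ᵐ v : ℝ, v ≠ r j := by simp [ae_iff]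
  filter_upwards [hne] with v hv hmem
  refine h.zero_before_release v j (lt_of_le_of_ne ?_ hv)
  have := hmem.2
  exact this.trans (max_le (hr j) hu)

theorem workDone_nonneg (hr : ∀ j, 0 ≤ r j) (h : IsSchedule r p σ) (j : J) (u : ℝ) :
    0 ≤ workDone σ j u := by
  rcases le_total u (r j) with hu | hu
  · exact (workDone_eq_zero hr h hu).ge
  · exact (workDone_eq_zero hr h le_rfl).ge.trans (h.workDone_mono j hu)

theorem lt_of_workDone_pos (hr : ∀ j, 0 ≤ r j) (h : IsSchedule r p σ) {j : J} {u : ℝ}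
    (hu : 0 < workDone σ j u) : r j < u := by
  by_contra! hle
  exact hu.ne' (workDone_eq_zero hr h hle)

theorem sum_workDone_sub (h : IsSchedule r p σ) (a b : ℝ) :
    ∑ j, (workDone σ j b - workDone σ j a) = ∫ v in a..b, ∑ j, σ v j := by
  rw [intervalIntegral.integral_finsetSum fun j _ => h.intervalIntegrable j a b]
  exact Finset.sum_congr rfl fun j _ => h.workDone_sub j a b

theorem sum_workDone_sub_le (h : IsSchedule r p σ) {a b : ℝ} (hab : a ≤ b) :
    ∑ j, (workDone σ j b - workDone σ j a) ≤ b - a := by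
  rw [h.sum_workDone_sub]
  have hint : IntervalIntegrable (fun v => ∑ j, σ v j) volume a b := by
    simpa only [Finset.sum_fn] using
      IntervalIntegrable.sum Finset.univ fun j _ => h.intervalIntegrable j a b
  calc ∫ v in a..b, ∑ j, σ v j ≤ ∫ _ in a..b, (1 : ℝ) :=
        intervalIntegral.integral_mono hab hint intervalIntegrable_const h.sum_le_one
    _ = b - a := by simp

theorem sum_workDone_sub_eq (h : IsSchedule r p σ) {a b : ℝ} (hab : a ≤ b)
    (hbusy : ∀ u ∈ Set.Ioc a b, ∑ j, σ u j = 1) :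
    ∑ j, (workDone σ j b - workDone σ j a) = b - a := by
  rw [h.sum_workDone_sub]
  calc ∫ v in a..b, ∑ j, σ v j = ∫ _ in a..b, (1 : ℝ) := by
        refine intervalIntegral.integral_congr_ae (Filter.Eventually.of_forall fun u hu => ?_)
        exact hbusy u (by rwa [Set.uIoc_of_le hab] at hu)
    _ = b - a := by simp

/-- A job whose work increases over `[a, b]` is processed at some time in between. -/
theorem exists_proc (h : IsSchedule r p σ) {j : J} {a b : ℝ} (hab : a ≤ b)
    (hlt : workDone σ j a < workDone σ j b) : ∃ u ∈ Set.Ioc a b, 0 < σ u j := by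
  by_contra! hno
  have h1 := h.workDone_sub j a b
  have h2 : ∫ v in a..b, σ v j = 0 := by
    refine intervalIntegral.integral_zero_ae (Filter.Eventually.of_forall fun u hu => ?_)
    exact le_antisymm (hno u (by rwa [Set.uIoc_of_le hab] at hu)) (h.nonneg u j)
  linarith

theorem exists_workDone_eq (h : IsSchedule r p σ) {j : J} {a b x : ℝ} (hab : a ≤ b)
    (ha : workDone σ j a ≤ x) (hb : x ≤ workDone σ j b) :
    ∃ v ∈ Set.Icc a b, workDone σ j v = x :=
  intermediate_value_Icc hab (h.workDone_continuous j).continuousOn ⟨ha, hb⟩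

theorem availAt_iff (h : IsSchedule r p σ) {j : J} {u : ℝ} :
    availAt r p σ u j ↔ r j ≤ u ∧ workDone σ j u < p j := by
  refine and_congr_right fun _ => ⟨fun hc => ?_, fun hy => ?_⟩
  · refine lt_of_le_of_ne (h.workDone_le u j) fun he => hc.not_ge ?_
    exact sInf_le ⟨u, he, rfl⟩
  · obtain ⟨v, huv, hv⟩ : ∃ v > u, workDone σ j v < p j := by
      have := ((h.workDone_continuous j).tendsto u).eventually_lt_const hy
      have h2 := (this.filter_mono nhdsWithin_le_nhds).and
        (self_mem_nhdsWithin (a := u) (s := Set.Ioi u))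
      obtain ⟨v, hv⟩ := h2.exists
      exact ⟨v, hv.2, hv.1⟩
    refine (EReal.coe_lt_coe_iff.2 huv).trans_le (le_sInf ?_)
    rintro _ ⟨w, hw, rfl⟩
    refine EReal.coe_le_coe_iff.2 ?_
    by_contra! hwv
    have hw' : workDone σ j w = p j := hw
    have := h.workDone_mono j hwv.le
    linarith

end IsSchedule

namespace IsALG

variable {J : Type*} [Fintype J] {r p : J → ℝ} {α : ℝ} {σ : ℝ → J → ℝ}

/-- Of two clairvoyant jobs, the one with larger remaining time is not processed. -/
theorem eq_zero_of_remT_lt (h : IsALG r p α σ) {u : ℝ} {i k : J}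
    (hi : clAt r p α σ u i) (hk : clAt r p α σ u k) (hlt : remT p σ i u < remT p σ k u) :
    σ u k = 0 := by
  by_cases hc : SrptCond r p α σ u
  · obtain ⟨m, hm, hz⟩ := h.srpt_branch u ⟨i, hi.1⟩ hc
    refine hz k ?_
    rintro rfl
    exact (hm.2.1 i hi).not_gt hlt
  · have hs := (h.setf_branch u ⟨i, hi.1⟩ hc).1 k
    by_contra hne
    exact (hs (lt_of_le_of_ne (h.sched.nonneg u k) (Ne.symm hne))).1.2.not_gt hk.2

/-- At most one clairvoyant job is processed at a time. -/
theorem eq_zero_or_eq_zero (h : IsALG r p α σ) {u : ℝ} {i k : J} (hik : i ≠ k)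
    (hi : clAt r p α σ u i) (hk : clAt r p α σ u k) : σ u i = 0 ∨ σ u k = 0 := by
  by_cases hc : SrptCond r p α σ u
  · obtain ⟨m, -, hz⟩ := h.srpt_branch u ⟨i, hi.1⟩ hc
    by_cases him : i = m
    · exact Or.inr (hz k fun hkm => hik (him.trans hkm.symm))
    · exact Or.inl (hz i him)
  · have hs := (h.setf_branch u ⟨i, hi.1⟩ hc).1 k
    right
    by_contra hne
    exact (hs (lt_of_le_of_ne (h.sched.nonneg u k) (Ne.symm hne))).1.2.not_gt hk.2

/-- If two clairvoyant jobs have equal remaining time at `v`, then the remaining time of the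
first one was not larger before. -/
theorem remT_le_of_eq (h : IsALG r p α σ) {c v : ℝ} {i k : J} (hcv : c ≤ v)
    (hi : ∀ u ∈ Set.Icc c v, clAt r p α σ u i) (hk : ∀ u ∈ Set.Icc c v, clAt r p α σ u k)
    (heq : remT p σ i v = remT p σ k v) : remT p σ i c ≤ remT p σ k c := by
  by_contra! hlt
  have hcont : Continuous fun u => remT p σ i u - remT p σ k u :=
    (continuous_const.sub (h.sched.workDone_continuous i)).sub
      (continuous_const.sub (h.sched.workDone_continuous k))
  let S := Set.Icc c v ∩ {u | remT p σ i u - remT p σ k u ≤ 0}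
  have hS : IsCompact S := isCompact_Icc.inter_right (isClosed_le hcont continuous_const)
  have hvS : v ∈ S := ⟨⟨hcv, le_rfl⟩, by simp [heq]⟩
  obtain ⟨w, hw, hmin⟩ := hS.exists_isLeast ⟨v, hvS⟩
  have hbefore : ∀ u ∈ Set.Ico c w, remT p σ k u < remT p σ i u := by
    intro u hu
    by_contra! hle
    exact hu.2.not_ge (hmin ⟨⟨hu.1, hu.2.le.trans hw.1.2⟩, sub_nonpos.2 hle⟩)
  have hconst : workDone σ i w ≤ workDone σ i c := by
    have h1 := h.sched.workDone_sub i c w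
    have h2 : ∫ u in c..w, σ u i = 0 := by
      refine intervalIntegral.integral_zero_ae ?_
      have hne : ∀ᵐ u : ℝ, u ≠ w := by simp [ae_iff]
      filter_upwards [hne] with u hu hmem
      rw [Set.uIoc_of_le hw.1.1] at hmem
      have huw : u < w := lt_of_le_of_ne hmem.2 hu
      have hucv : u ∈ Set.Icc c v := ⟨hmem.1.le, huw.le.trans hw.1.2⟩
      exact h.eq_zero_of_remT_lt (hk u hucv) (hi u hucv) (hbefore u ⟨hmem.1.le, huw⟩)
    linarith
  have hmono := h.sched.workDone_mono k hw.1.1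
  have hw2 : remT p σ i w - remT p σ k w ≤ 0 := hw.2
  simp only [remT] at *
  linarith

/-- Two clairvoyant jobs with equal remaining time at `v` are not processed before `v`
while both are clairvoyant. -/
theorem workDone_eq_of_remT_eq (h : IsALG r p α σ) {c v : ℝ} {i k : J} (hik : i ≠ k)
    (hcv : c ≤ v) (hi : ∀ u ∈ Set.Icc c v, clAt r p α σ u i)
    (hk : ∀ u ∈ Set.Icc c v, clAt r p α σ u k) (heq : remT p σ i v = remT p σ k v) :
    workDone σ i c = workDone σ i v := by
  have hrem : ∀ u ∈ Set.Icc c v, remT p σ i u = remT p σ k u := fun u hu =>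
    le_antisymm
      (h.remT_le_of_eq hu.2 (fun w hw => hi w ⟨hu.1.trans hw.1, hw.2⟩)
        (fun w hw => hk w ⟨hu.1.trans hw.1, hw.2⟩) heq)
      (h.remT_le_of_eq hu.2 (fun w hw => hk w ⟨hu.1.trans hw.1, hw.2⟩)
        (fun w hw => hi w ⟨hu.1.trans hw.1, hw.2⟩) heq.symm)
  let f : ℝ → ℝ := fun u => σ u i - σ u k
  have hf : IntervalIntegrable f volume c v :=
    (h.sched.intervalIntegrable i c v).sub (h.sched.intervalIntegrable k c v)
  have hzero : ∀ᵐ x, x ∈ Set.uIcc c v → HasDerivAt (fun u => ∫ w in c..u, f w) (f x) x := by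
    have := hf.ae_hasDerivAt_integral
    filter_upwards [this] with x hx hmem
    exact hx hmem c (by simp)
  have hprim : ∀ u ∈ Set.Icc c v, ∫ w in c..u, f w = 0 := by
    intro u hu
    have h1 : ∫ w in c..u, f w = (∫ w in c..u, σ w i) - ∫ w in c..u, σ w k :=
      intervalIntegral.integral_sub (h.sched.intervalIntegrable i c u)
        (h.sched.intervalIntegrable k c u)
    rw [h1, ← h.sched.workDone_sub, ← h.sched.workDone_sub]
    have h2 := hrem u hu
    have h3 := hrem c ⟨le_rfl, hcv⟩
    simp only [remT] at h2 h3
    linarith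
  have hint : ∫ u in c..v, σ u i = 0 := by
    refine intervalIntegral.integral_zero_ae ?_
    have hne : ∀ᵐ u : ℝ, u ≠ v := by simp [ae_iff]
    filter_upwards [hzero, hne] with x hx hxv hmem
    rw [Set.uIoc_of_le hcv] at hmem
    have hxI : x ∈ Set.Icc c v := ⟨hmem.1.le, hmem.2⟩
    have hd := hx (by rwa [Set.uIcc_of_le hcv])
    have hev : (fun u => ∫ w in c..u, f w) =ᶠ[nhds x] fun _ => (0 : ℝ) := by
      filter_upwards [Ioo_mem_nhds hmem.1 (lt_of_le_of_ne hmem.2 hxv)] with u hu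
      exact hprim u ⟨hu.1.le, hu.2.le⟩
    have hfx : f x = 0 := hd.unique ((hasDerivAt_const x (0 : ℝ)).congr_of_eventuallyEq hev)
    have hfx' : σ x i - σ x k = 0 := hfx
    rcases h.eq_zero_or_eq_zero hik (hi x hxI) (hk x hxI) with h0 | h0 <;> linarith
  have := h.sched.workDone_sub i c v
  linarith

/-- Distinct clairvoyant jobs have distinct remaining processing times. -/
theorem remT_ne (hinst : IsInstance r p α) (h : IsALG r p α σ) {v : ℝ} {i k : J} (hik : i ≠ k)
    (hi : clAt r p α σ v i) (hk : clAt r p α σ v k) : remT p σ i v ≠ remT p σ k v := by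
  intro heq
  have hαp : ∀ j, 0 < α * p j := fun j => mul_pos hinst.alpha_mem.1 (hinst.p_pos j)
  let g : ℝ → ℝ := fun u => min (workDone σ i u - α * p i) (workDone σ k u - α * p k)
  have hg : Continuous g :=
    ((h.sched.workDone_continuous i).sub continuous_const).min
      ((h.sched.workDone_continuous k).sub continuous_const)
  have hgv : 0 < g v := lt_min (sub_pos.2 hi.2) (sub_pos.2 hk.2)
  have hv : 0 ≤ v := (hinst.r_nonneg i).trans hi.1.1
  have hg0 : g 0 ≤ g v / 2 := by
    have h0 : workDone σ i 0 = 0 :=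
      IsSchedule.workDone_eq_zero hinst.r_nonneg h.sched (hinst.r_nonneg i)
    have h1 : g 0 ≤ workDone σ i 0 - α * p i := min_le_left _ _
    have := hαp i
    linarith
  obtain ⟨c, hc, hgc⟩ := intermediate_value_Icc hv hg.continuousOn ⟨hg0, by linarith⟩
  have hcl : ∀ j, clAt r p α σ v j → g c ≤ workDone σ j c - α * p j →
      ∀ u ∈ Set.Icc c v, clAt r p α σ u j := by
    intro j hj hgj u hu
    have hm := h.sched.workDone_mono j hu.1
    have hm' := h.sched.workDone_mono j hu.2
    have hlt : α * p j < workDone σ j u := by linarith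
    have hy := (h.sched.availAt_iff.1 hj.1).2
    exact ⟨h.sched.availAt_iff.2
      ⟨(IsSchedule.lt_of_workDone_pos hinst.r_nonneg h.sched ((hαp j).trans hlt)).le,
        by linarith⟩, hlt⟩
  have hicl := hcl i hi (min_le_left _ _)
  have hkcl := hcl k hk (min_le_right _ _)
  have h1 := h.workDone_eq_of_remT_eq hik hc.2 hicl hkcl heq
  have h2 := h.workDone_eq_of_remT_eq hik.symm hc.2 hkcl hicl heq.symm
  have : g c = g v := by simp only [g, h1, h2]
  linarith

end IsALG

/-- `j` is available and has priority over the level `Y`: its progress is below `Y` while it is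
non-clairvoyant, or its remaining time is below `((1 - α) / α) * Y` once it is clairvoyant. -/
def IsBelow {J : Type*} (r p : J → ℝ) (α : ℝ) (σ : ℝ → J → ℝ) (Y u : ℝ) (j : J) : Prop :=
  (ncAt r p α σ u j ∧ workDone σ j u < Y) ∨
    (clAt r p α σ u j ∧ remT p σ j u < (1 - α) / α * Y)

theorem IsBelow.availAt {J : Type*} {r p : J → ℝ} {α : ℝ} {σ : ℝ → J → ℝ} {Y u : ℝ} {j : J}
    (h : IsBelow r p α σ Y u j) : availAt r p σ u j :=
  h.elim (fun h => h.1.1) fun h => h.1.1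

/-- The last time until `t` at which no job is below the level `Y`. -/
noncomputable def lastAbove {J : Type*} (r p : J → ℝ) (α : ℝ) (σ : ℝ → J → ℝ) (Y t : ℝ) : ℝ :=
  sSup {u | u ≤ t ∧ ∀ j, ¬ IsBelow r p α σ Y u j}

section LastAbove

variable {J : Type*} {r p : J → ℝ} {α : ℝ} {σ : ℝ → J → ℝ}

theorem lastAbove_le (hinst : IsInstance r p α) {Y t : ℝ} :
    lastAbove r p α σ Y t ≤ t ∧ ∀ ε > 0, ∃ u, lastAbove r p α σ Y t - ε < u ∧
      u ≤ lastAbove r p α σ Y t ∧ ∀ j, ¬ IsBelow r p α σ Y u j := by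
  have hne : {u | u ≤ t ∧ ∀ j, ¬ IsBelow r p α σ Y u j}.Nonempty := by
    refine ⟨min t (-1), min_le_left _ _, fun j hj => ?_⟩
    have h1 := hj.availAt.1
    have h2 := hinst.r_nonneg j
    have h3 := min_le_right t (-1)
    linarith
  have hbdd : BddAbove {u | u ≤ t ∧ ∀ j, ¬ IsBelow r p α σ Y u j} := ⟨t, fun u hu => hu.1⟩
  refine ⟨csSup_le hne fun u hu => hu.1, fun ε hε => ?_⟩
  obtain ⟨u, hu, hlt⟩ := exists_lt_of_lt_csSup hne (sub_lt_self _ hε)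
  exact ⟨u, hlt, le_csSup hbdd hu, hu.2⟩

theorem exists_isBelow {Y t u : ℝ} (hu : u ∈ Set.Ioc (lastAbove r p α σ Y t) t) :
    ∃ j, IsBelow r p α σ Y u j := by
  by_contra! hno
  have hbdd : BddAbove {u | u ≤ t ∧ ∀ j, ¬ IsBelow r p α σ Y u j} := ⟨t, fun u hu => hu.1⟩
  exact hu.1.not_ge (le_csSup hbdd ⟨hu.2, hno⟩)

/-- A property that holds near `lastAbove` holds at some time close before it at which no job is
below the level. -/
theorem exists_above_of_eventually (hinst : IsInstance r p α) {Y t : ℝ} {P : ℝ → Prop}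
    (hP : ∀ᶠ u in nhds (lastAbove r p α σ Y t), P u) :
    ∃ u ≤ lastAbove r p α σ Y t, P u ∧ ∀ j, ¬ IsBelow r p α σ Y u j := by
  obtain ⟨ε, hε, hball⟩ := Metric.eventually_nhds_iff.1 hP
  obtain ⟨u, h1, h2, h3⟩ := (lastAbove_le (σ := σ) hinst (Y := Y) (t := t)).2 ε hε
  refine ⟨u, h2, hball ?_, h3⟩
  rw [Real.dist_eq, abs_lt]
  constructor <;> linarith

end LastAbove

namespace IsALG

variable {J : Type*} [Fintype J] {r p : J → ℝ} {α : ℝ} {σ : ℝ → J → ℝ}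

theorem isBelow_of_proc (hinst : IsInstance r p α) (h : IsALG r p α σ) {Y u : ℝ} {i j : J}
    (hj : IsBelow r p α σ Y u j) (hi : 0 < σ u i) : IsBelow r p α σ Y u i := by
  have hβ : 0 < (1 - α) / α :=
    div_pos (sub_pos.2 hinst.alpha_mem.2) hinst.alpha_mem.1
  by_cases hc : SrptCond r p α σ u
  · obtain ⟨k, hk, hz⟩ := h.srpt_branch u ⟨j, hj.availAt⟩ hc
    have hik : i = k := by
      by_contra hne
      exact hi.ne' (hz i hne)
    subst hik
    refine Or.inr ⟨hk.1, ?_⟩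
    rcases hj with hj | hj
    · obtain ⟨m, hm, hmin⟩ := hc
      exact ((hk.2.1 m hm).trans (hmin j hj.1)).trans_lt (mul_lt_mul_of_pos_left hj.2 hβ)
    · exact (hk.2.1 j hj.1).trans_lt hj.2
  · have hs := (h.setf_branch u ⟨j, hj.availAt⟩ hc).1 i hi
    refine Or.inl ⟨hs.1, ?_⟩
    rcases hj with hj | hj
    · exact (hs.2 j hj.1).trans_lt hj.2
    · have hex : ∃ m, ncAt r p α σ u m ∧ (1 - α) / α * workDone σ m u < remT p σ j u := by
        by_contra! hno
        exact hc ⟨j, hj.1, hno⟩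
      obtain ⟨m, hm, hlt⟩ := hex
      exact (hs.2 m hm).trans_lt (lt_of_mul_lt_mul_left (hlt.trans hj.2) hβ.le)

/-- A non-clairvoyant job below the level was released after `lastAbove`. -/
theorem lastAbove_le_release (hinst : IsInstance r p α) (h : IsALG r p α σ) {Y t : ℝ} {j : J}
    (hj : ncAt r p α σ t j) (hY : workDone σ j t < Y) : lastAbove r p α σ Y t ≤ r j := by
  by_contra! hlt
  obtain ⟨u, hu, hru, hno⟩ := exists_above_of_eventually hinst (lt_mem_nhds hlt)
  have hm := h.sched.workDone_mono j (hu.trans (lastAbove_le hinst).1)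
  have ha := (h.sched.availAt_iff.1 hj.1).2
  have := hj.2
  exact hno j (Or.inl ⟨⟨h.sched.availAt_iff.2 ⟨le_of_lt hru, by linarith⟩, by linarith⟩,
    by linarith⟩)

/-- The truncated progress of a job released after `lastAbove` is at most the level. -/
theorem truncY_le (hinst : IsInstance r p α) (h : IsALG r p α σ) {Y t : ℝ} {i : J}
    (hY : 0 ≤ Y) (hi : lastAbove r p α σ Y t ≤ r i) : truncY p α σ t i ≤ Y := by
  by_contra! hlt
  set τ := lastAbove r p α σ Y t
  have hτ : τ ≤ t := (lastAbove_le hinst).1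
  have h0 : workDone σ i τ = 0 := IsSchedule.workDone_eq_zero hinst.r_nonneg h.sched hi
  have hzt : truncY p α σ t i ≤ workDone σ i t := min_le_left _ _
  have hzp : truncY p α σ t i ≤ α * p i := min_le_right _ _
  obtain ⟨v, hv, hyv⟩ := h.sched.exists_workDone_eq hτ (x := truncY p α σ t i)
    (by linarith) hzt
  obtain ⟨w, hw, hyw⟩ := h.sched.exists_workDone_eq hv.1 (x := Y) (by linarith) (by linarith)
  obtain ⟨u, hu, hproc⟩ := h.sched.exists_proc hw.2 (by linarith)
  obtain ⟨k, hk⟩ := exists_isBelow (r := r) (p := p) (α := α) (σ := σ) (Y := Y)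
      (t := t)
    ⟨hw.1.trans_lt hu.1, hu.2.trans hv.2⟩
  have m1 := h.sched.workDone_mono i hu.1.le
  have m2 := h.sched.workDone_mono i hu.2
  rcases h.isBelow_of_proc hinst hk hproc with hb | hb
  · linarith [hb.2]
  · linarith [hb.1.2]

/-- A job released before `lastAbove` and processed afterwards is clairvoyant at `lastAbove`
and has remaining time exactly at the level. -/
theorem clAt_lastAbove (hinst : IsInstance r p α) (h : IsALG r p α σ) {Y t : ℝ} {i : J}
    (hY : α * p i ≠ Y) (hi : r i < lastAbove r p α σ Y t)
    (hlt : workDone σ i (lastAbove r p α σ Y t) < workDone σ i t) :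
    clAt r p α σ (lastAbove r p α σ Y t) i ∧
      remT p σ i (lastAbove r p α σ Y t) = (1 - α) / α * Y := by
  have hα := hinst.alpha_mem
  set β := (1 - α) / α with hβdef
  have hβ : 0 < β := div_pos (sub_pos.2 hα.2) hα.1
  have hβα : β * α = 1 - α := by rw [hβdef]; field_simp [hα.1.ne']
  set τ := lastAbove r p α σ Y t
  have hτ : τ ≤ t := (lastAbove_le hinst).1
  have hp : workDone σ i τ < p i := hlt.trans_le (h.sched.workDone_le t i)
  have hav : ∀ u, r i < u → u ≤ τ → availAt r p σ u i := fun u h1 h2 =>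
    h.sched.availAt_iff.2 ⟨h1.le, (h.sched.workDone_mono i h2).trans_lt hp⟩
  have hle : remT p σ i τ ≤ β * Y := by
    by_contra! hgt
    simp only [remT] at hgt
    obtain ⟨v, hv, hyv⟩ := h.sched.exists_workDone_eq hτ
      (x := min (workDone σ i t) (p i - β * Y)) (le_min hlt.le (by linarith)) (min_le_left _ _)
    have hτv : workDone σ i τ < workDone σ i v := by
      rw [hyv]; exact lt_min hlt (by linarith)
    obtain ⟨u, hu, hproc⟩ := h.sched.exists_proc hv.1 hτv
    obtain ⟨k, hk⟩ := exists_isBelow (r := r) (p := p) (α := α) (σ := σ) (Y := Y)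
      (t := t)
      ⟨hu.1, hu.2.trans hv.2⟩
    have m2 := h.sched.workDone_mono i hu.2
    have hmin := min_le_right (workDone σ i t) (p i - β * Y)
    rcases h.isBelow_of_proc hinst hk hproc with hb | hb
    · obtain ⟨w, hw, hrw, hno⟩ := exists_above_of_eventually hinst (lt_mem_nhds hi)
      have m1 := h.sched.workDone_mono i (hw.trans hu.1.le)
      have hb1 := hb.1.2
      have hb2 := hb.2
      exact hno i (Or.inl ⟨⟨hav w hrw hw, by linarith⟩, by linarith⟩)
    · have hb2 := hb.2
      simp only [remT] at hb2
      linarith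
  have hcl : α * p i < workDone σ i τ := by
    by_contra! hnc
    obtain ⟨w, hw, hrw, hno⟩ := exists_above_of_eventually hinst (lt_mem_nhds hi)
    have m1 := h.sched.workDone_mono i hw
    have hYw : Y ≤ workDone σ i w := by
      by_contra! hYw
      exact hno i (Or.inl ⟨⟨hav w hrw hw, by linarith⟩, hYw⟩)
    refine hY (le_antisymm ?_ (by linarith))
    refine le_of_mul_le_mul_left ?_ hβ
    simp only [remT] at hle
    calc β * (α * p i) = (1 - α) * p i := by rw [← mul_assoc, hβα]
      _ ≤ β * Y := by linarith
  refine ⟨⟨hav τ hi le_rfl, hcl⟩, hle.antisymm ?_⟩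
  by_contra! hrem
  have hcont := h.sched.workDone_continuous i
  have e1 := (hcont.tendsto τ).eventually_const_lt hcl
  have e2 : ∀ᶠ u in nhds τ, remT p σ i u < β * Y :=
    ((continuous_const.sub hcont).tendsto τ).eventually_lt_const hrem
  obtain ⟨w, hw, ⟨hrw, hc, hr⟩, hno⟩ :=
    exists_above_of_eventually hinst ((lt_mem_nhds hi).and (e1.and e2))
  exact hno i (Or.inr ⟨⟨hav w hrw hw, hc⟩, hr⟩)

/-- After `lastAbove`, at most `((1 - α) / α) * Y` work is done on jobs released before it. -/
theorem sum_old_le (hinst : IsInstance r p α) (h : IsALG r p α σ) {Y t : ℝ} (hY0 : 0 < Y)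
    (hY : ∀ i, α * p i ≠ Y) :
    ∑ i, (if r i < lastAbove r p α σ Y t then
        workDone σ i t - workDone σ i (lastAbove r p α σ Y t) else 0)
      ≤ if ∃ i, (1 - α) / α * Y ≤ p i then (1 - α) / α * Y else 0 := by
  have hβ : 0 < (1 - α) / α := div_pos (sub_pos.2 hinst.alpha_mem.2) hinst.alpha_mem.1
  set τ := lastAbove r p α σ Y t
  have hτ : τ ≤ t := (lastAbove_le hinst).1
  by_cases hex : ∃ i, r i < τ ∧ workDone σ i τ < workDone σ i t
  · obtain ⟨i, hi, hlt⟩ := hex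
    obtain ⟨hcl, hrem⟩ := h.clAt_lastAbove hinst (hY i) hi hlt
    have hpi : (1 - α) / α * Y ≤ p i := by
      rw [← hrem, remT]
      linarith [IsSchedule.workDone_nonneg hinst.r_nonneg h.sched i τ]
    rw [if_pos ⟨i, hpi⟩, Finset.sum_eq_single i, if_pos hi, ← hrem, remT]
    · linarith [h.sched.workDone_le t i]
    · intro k _ hki
      split_ifs with hk
      · by_contra hne
        have hlt' : workDone σ k τ < workDone σ k t :=
          lt_of_le_of_ne (h.sched.workDone_mono k hτ) fun he => hne (by rw [he, sub_self])
        obtain ⟨hcl', hrem'⟩ := h.clAt_lastAbove hinst (hY k) hk hlt'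
        exact h.remT_ne hinst hki hcl' hcl (hrem'.trans hrem.symm)
      · rfl
    · simp
  · push Not at hex
    refine (Finset.sum_nonpos fun i _ => ?_).trans (by split_ifs <;> positivity)
    split_ifs with hi
    · linarith [hex i hi]
    · exact le_rfl

/-- Volume comparison at the level `Y`. -/
theorem sum_deficit_le (hinst : IsInstance r p α) (h : IsALG r p α σ) {σO : ℝ → J → ℝ}
    (hO : IsSchedule r p σO) {Y t : ℝ} (hY0 : 0 < Y) (hY : ∀ i, α * p i ≠ Y) :
    ∑ j with (ncAt r p α σ t j ∧ ¬ availAt r p σO t j) ∧ workDone σ j t < Y, (1 - α) * p j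
      ≤ (∑ i with availAt r p σO t i ∧ truncY p α σ t i ≤ Y, truncY p α σ t i / α)
        + if ∃ i, (1 - α) / α * Y ≤ p i then (1 - α) / α * Y else 0 := by
  have hα := hinst.alpha_mem
  refine le_trans ?_ (add_le_add_right (h.sum_old_le hinst (t := t) hY0 hY) _)
  set τ := lastAbove r p α σ Y t
  have hτ : τ ≤ t := (lastAbove_le hinst).1
  have hbusy : ∀ u ∈ Set.Ioc τ t, ∑ j, σ u j = 1 := fun u hu => by
    obtain ⟨j, hj⟩ := exists_isBelow hu
    exact h.nonidling u ⟨j, hj.availAt⟩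
  have hvol : ∑ j, (workDone σO j t - workDone σO j τ)
      ≤ ∑ j, (workDone σ j t - workDone σ j τ) :=
    (hO.sum_workDone_sub_le hτ).trans (h.sched.sum_workDone_sub_eq hτ hbusy).ge
  rw [Finset.sum_filter, Finset.sum_filter, ← Finset.sum_add_distrib]
  refine sub_nonpos.1 (le_trans ?_ (sub_nonpos.2 hvol))
  rw [← Finset.sum_sub_distrib, ← Finset.sum_sub_distrib]
  refine Finset.sum_le_sum fun i _ => ?_
  have hOm := hO.workDone_mono i hτ
  have hm := h.sched.workDone_mono i hτ
  have hy0 := IsSchedule.workDone_nonneg hinst.r_nonneg h.sched i t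
  have hO0 := IsSchedule.workDone_nonneg hinst.r_nonneg hO i t
  have hple := h.sched.workDone_le t i
  have hp := hinst.p_pos i
  have hz0 : 0 ≤ truncY p α σ t i := le_min hy0 (mul_pos hα.1 hp).le
  have hzα : workDone σ i t ≤ truncY p α σ t i / α := by
    rw [le_div_iff₀ hα.1]
    exact le_min (mul_le_of_le_one_right hy0 hα.2.le)
      (by rw [mul_comm]; exact mul_le_mul_of_nonneg_left hple hα.1.le)
  by_cases hold : r i < τ
  · have hD : ¬ ((ncAt r p α σ t i ∧ ¬ availAt r p σO t i) ∧ workDone σ i t < Y) := fun hD =>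
      hold.not_ge (h.lastAbove_le_release hinst hD.1.1 hD.2)
    rw [if_neg hD, if_pos hold]
    have : 0 ≤ if availAt r p σO t i ∧ truncY p α σ t i ≤ Y then truncY p α σ t i / α else 0 := by
      split_ifs
      · exact div_nonneg hz0 hα.1.le
      · exact le_rfl
    linarith
  · rw [if_neg hold]
    push Not at hold
    have e1 := IsSchedule.workDone_eq_zero hinst.r_nonneg hO hold
    have e2 := IsSchedule.workDone_eq_zero hinst.r_nonneg h.sched hold
    by_cases hav : availAt r p σO t i
    · rw [if_neg fun hD => hD.1.2 hav, if_pos ⟨hav, h.truncY_le hinst hY0.le hold⟩]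
      linarith
    · rw [if_neg (fun hz : availAt r p σO t i ∧ truncY p α σ t i ≤ Y => hav hz.1)]
      rcases lt_or_ge t (r i) with hrt | hrt
      · rw [if_neg fun hD => hrt.not_ge hD.1.1.1.1]
        have := IsSchedule.workDone_eq_zero hinst.r_nonneg h.sched hrt.le
        linarith
      · have hdone : workDone σO i t = p i :=
          le_antisymm (hO.workDone_le t i) (not_lt.1 fun hlt => hav (hO.availAt_iff.2 ⟨hrt, hlt⟩))
        split_ifs with hD
        · linarith [hD.1.1.2]
        · linarith

end IsALG

/-- A finite family dominating another one at every level has the larger sum. -/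
theorem Finset.sum_le_sum_of_card_filter_le {ι κ : Type*} (s : Finset ι) (T : Finset κ)
    (z : ι → ℝ) (y : κ → ℝ) (hy : ∀ j ∈ T, 0 ≤ y j)
    (hcard : ∀ i ∈ s, (s.filter fun i' => z i ≤ z i').card ≤ (T.filter fun j => z i ≤ y j).card) :
    ∑ i ∈ s, z i ≤ ∑ j ∈ T, y j := by
  induction s using Finset.strongInduction generalizing T with
  | H s ih =>
    rcases s.eq_empty_or_nonempty with rfl | hs
    · simpa using Finset.sum_nonneg hy
    obtain ⟨a, ha, hmax⟩ := s.exists_max_image z hs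
    have hTa : (T.filter fun j => z a ≤ y j).Nonempty := by
      rw [← Finset.card_pos]
      exact (Finset.card_pos.2 ⟨a, Finset.mem_filter.2 ⟨ha, le_refl (z a)⟩⟩).trans_le (hcard a ha)
    obtain ⟨b, hb⟩ := hTa
    rw [Finset.mem_filter] at hb
    have := ih (s.erase a) (Finset.erase_ssubset ha) (T.erase b)
      (fun j hj => hy j (Finset.mem_of_mem_erase hj)) fun i hi => by
        have his := Finset.mem_of_mem_erase hi
        have h1 := hcard i his
        rw [Finset.filter_erase, Finset.filter_erase, Finset.card_erase_of_mem,
          Finset.card_erase_of_mem]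
        · omega
        · exact Finset.mem_filter.2 ⟨hb.1, (hmax i his).trans hb.2⟩
        · exact Finset.mem_filter.2 ⟨ha, hmax i his⟩
    rw [← Finset.add_sum_erase s z ha, ← Finset.add_sum_erase T y hb.1]
    exact add_le_add hb.2 this

/-- If at every level `y k` the family `y` sums, up to one extra copy of `y k`, to at most `K`
times the part of the family `z` up to that level, then `y` has at most `K * #O + 1` members. -/
theorem card_le_of_sum_le {ι κ : Type*} (D : Finset κ) (O : Finset ι) (y : κ → ℝ) (z : ι → ℝ)
    (K : ℕ) (hy : ∀ j ∈ D, 0 < y j)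
    (hsum : ∀ k ∈ D, ∑ j ∈ D with y j ≤ y k, y j ≤ y k + K * ∑ i ∈ O with z i ≤ y k, z i) :
    D.card ≤ K * O.card + 1 := by
  have key : ∀ k ∈ D, (D.filter fun j => y j ≤ y k).card
      ≤ K * (O.filter fun i => z i ≤ y k).card + 1 := by
    by_contra! hbad
    obtain ⟨k₀, hk₀, hlt₀⟩ := hbad
    let B := D.filter fun k => K * (O.filter fun i => z i ≤ y k).card + 1
      < (D.filter fun j => y j ≤ y k).card
    obtain ⟨k, hkB, hmin⟩ := B.exists_min_image y ⟨k₀, Finset.mem_filter.2 ⟨hk₀, hlt₀⟩⟩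
    obtain ⟨hk, hlt⟩ := Finset.mem_filter.1 hkB
    have hbelow : ∀ s ≤ y k, (D.filter fun j => y j < s).card
        ≤ K * (O.filter fun i => z i < s).card + 1 := by
      intro s hs
      rcases (D.filter fun j => y j < s).eq_empty_or_nonempty with he | hne
      · simp [he]
      obtain ⟨m, hm, hmax⟩ := Finset.exists_max_image _ y hne
      obtain ⟨hmD, hms⟩ := Finset.mem_filter.1 hm
      have hgood : (D.filter fun j => y j ≤ y m).card
          ≤ K * (O.filter fun i => z i ≤ y m).card + 1 := by
        by_contra! hc
        exact (hms.trans_le hs).not_ge (hmin m (Finset.mem_filter.2 ⟨hmD, hc⟩))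
      have h1 : (D.filter fun j => y j < s).card ≤ (D.filter fun j => y j ≤ y m).card :=
        Finset.card_le_card fun j hj =>
          Finset.mem_filter.2 ⟨(Finset.mem_filter.1 hj).1, hmax j hj⟩
      have h2 : (O.filter fun i => z i ≤ y m).card ≤ (O.filter fun i => z i < s).card :=
        Finset.card_le_card fun i hi =>
          Finset.mem_filter.2 ⟨(Finset.mem_filter.1 hi).1, (Finset.mem_filter.1 hi).2.trans_lt hms⟩
      have := Nat.mul_le_mul_left K h2
      omega
    set E := D.filter fun j => y j ≤ y k with hE
    set A := O.filter fun i => z i ≤ y k with hA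
    have hkE : k ∈ E := Finset.mem_filter.2 ⟨hk, le_rfl⟩
    have hEne : (E.erase k).Nonempty := by
      rw [← Finset.card_pos, Finset.card_erase_of_mem hkE]
      omega
    obtain ⟨b, hb, hbmin⟩ := (E.erase k).exists_min_image y hEne
    have hbE := Finset.mem_of_mem_erase hb
    have hdom : ∑ q ∈ A ×ˢ Finset.range K, z q.1 ≤ ∑ j ∈ (E.erase k).erase b, y j := by
      refine Finset.sum_le_sum_of_card_filter_le _ _ (fun q : ι × ℕ => z q.1) y
        (fun j hj => (hy j ?_).le) ?_
      · exact (Finset.mem_filter.1 (Finset.mem_of_mem_erase (Finset.mem_of_mem_erase hj))).1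
      rintro ⟨i, c⟩ hic
      have hiA : i ∈ A := (Finset.mem_product.1 hic).1
      have hik : z i ≤ y k := (Finset.mem_filter.1 hiA).2
      have hprod : ((A ×ˢ Finset.range K).filter fun q => z i ≤ z q.1)
          = (A.filter fun i' => z i ≤ z i') ×ˢ Finset.range K := by
        ext q
        simp only [Finset.mem_filter, Finset.mem_product]
        tauto
      have hsplitA : (A.filter fun i' => z i ≤ z i').card + (O.filter fun i' => z i' < z i).card
          = A.card := by
        rw [← Finset.card_filter_add_card_filter_not (s := A) (fun i' => z i ≤ z i')]
        congr 2
        ext i'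
        simp only [hA, Finset.mem_filter, not_le]
        exact ⟨fun hh => ⟨⟨hh.1, hh.2.le.trans hik⟩, hh.2⟩, fun hh => ⟨hh.1.1, hh.2⟩⟩
      have hcardE : K * A.card + 2 ≤ E.card := hlt
      have hmulA : K * (A.filter fun i' => z i ≤ z i').card
          + K * (O.filter fun i' => z i' < z i).card = K * A.card := by
        rw [← Nat.mul_add, hsplitA]
      simp only [hprod, Finset.card_product, Finset.card_range]
      rw [mul_comm]
      by_cases hbi : z i ≤ y b
      · rw [Finset.filter_true_of_mem fun j hj => hbi.trans (hbmin j (Finset.mem_of_mem_erase hj)),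
          Finset.card_erase_of_mem hb, Finset.card_erase_of_mem hkE]
        omega
      · have hbl := hbelow (z i) hik
        have hsplitE : (E.filter fun j => z i ≤ y j).card + (D.filter fun j => y j < z i).card
            = E.card := by
          rw [← Finset.card_filter_add_card_filter_not (s := E) (fun j => z i ≤ y j)]
          congr 2
          ext j
          simp only [hE, Finset.mem_filter, not_le]
          exact ⟨fun hh => ⟨⟨hh.1, hh.2.le.trans hik⟩, hh.2⟩, fun hh => ⟨hh.1.1, hh.2⟩⟩
        have hnb : b ∉ (E.erase k).filter fun j => z i ≤ y j :=
          fun hmem => hbi (Finset.mem_filter.1 hmem).2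
        rw [Finset.filter_erase, Finset.erase_eq_of_notMem hnb, Finset.filter_erase,
          Finset.card_erase_of_mem (Finset.mem_filter.2 ⟨hkE, hik⟩)]
        omega
    have hprodsum : ∑ q ∈ A ×ˢ Finset.range K, z q.1 = K * ∑ i ∈ A, z i := by
      rw [Finset.sum_product, Finset.mul_sum]
      simp
    have hsk := hsum k hk
    rw [← hE, ← hA, ← Finset.add_sum_erase E y hkE, ← Finset.add_sum_erase _ y hb] at hsk
    have := hy b (Finset.mem_filter.1 hbE).1
    linarith
  rcases D.eq_empty_or_nonempty with rfl | hD
  · simp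
  obtain ⟨k, hk, hmax⟩ := D.exists_max_image y hD
  have h1 := key k hk
  rw [Finset.filter_true_of_mem hmax] at h1
  have h2 := Nat.mul_le_mul_left K (Finset.card_filter_le O fun i => z i ≤ y k)
  omega

/-- A finite set of levels can be avoided arbitrarily close above a given level. -/
theorem eventually_nhdsGT_forall_ne {J : Type*} [Finite J] (x : ℝ) (f : J → ℝ) :
    ∀ᶠ Y in nhdsWithin x (Set.Ioi x), ∀ i, f i ≠ Y := by
  rw [Filter.eventually_all]
  intro i
  rcases le_or_gt (f i) x with hle | hgt
  · filter_upwards [self_mem_nhdsWithin] with Y hY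
    exact (hle.trans_lt hY).ne
  · filter_upwards [nhdsWithin_le_nhds (gt_mem_nhds hgt)] with Y hY
    exact ne_of_gt hY

namespace IsALG

variable {J : Type*} [Fintype J] {r p : J → ℝ} {α : ℝ} {σ : ℝ → J → ℝ}

/-- Jobs finished by the other schedule but still non-clairvoyant have been processed. -/
theorem workDone_pos (hinst : IsInstance r p α) (h : IsALG r p α σ) {σO : ℝ → J → ℝ}
    (hO : IsSchedule r p σO) {t : ℝ} {j : J} (hj : ncAt r p α σ t j)
    (hjO : ¬ availAt r p σO t j) : 0 < workDone σ j t := by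
  have hα := hinst.alpha_mem
  have hβ : 0 < (1 - α) / α := div_pos (sub_pos.2 hα.2) hα.1
  refine lt_of_le_of_ne (IsSchedule.workDone_nonneg hinst.r_nonneg h.sched j t) fun h0 => ?_
  set C : ℝ := Fintype.card J / α + (1 - α) / α
  have hlim : Filter.Tendsto (fun Y : ℝ => C * Y) (nhdsWithin 0 (Set.Ioi 0)) (nhds 0) := by
    have : Filter.Tendsto (fun Y : ℝ => C * Y) (nhds 0) (nhds (C * 0)) :=
      (continuous_const.mul continuous_id).tendsto 0
    rw [mul_zero] at this
    exact this.mono_left nhdsWithin_le_nhds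
  have hpos : 0 < (1 - α) * p j := mul_pos (sub_pos.2 hα.2) (hinst.p_pos j)
  obtain ⟨Y, ⟨hYC, hYne⟩, hY0⟩ := (((hlim.eventually_lt_const hpos).and
    (eventually_nhdsGT_forall_ne 0 fun i => α * p i)).and self_mem_nhdsWithin).exists
  have hY0 : 0 < Y := hY0
  have hmain := h.sum_deficit_le hinst hO (t := t) hY0 hYne
  have h1 : (1 - α) * p j ≤ ∑ j with (ncAt r p α σ t j ∧ ¬ availAt r p σO t j)
      ∧ workDone σ j t < Y, (1 - α) * p j :=
    Finset.single_le_sum (f := fun j => (1 - α) * p j)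
      (fun i _ => (mul_pos (sub_pos.2 hα.2) (hinst.p_pos i)).le)
      (Finset.mem_filter.2 ⟨Finset.mem_univ j, ⟨hj, hjO⟩, by rwa [← h0]⟩)
  have h2 : ∑ i with availAt r p σO t i ∧ truncY p α σ t i ≤ Y, truncY p α σ t i / α
      ≤ Fintype.card J / α * Y := by
    refine (Finset.sum_le_card_nsmul _ _ (Y / α) fun i hi => ?_).trans ?_
    · exact div_le_div_of_nonneg_right (Finset.mem_filter.1 hi).2.2 hα.1.le
    · rw [nsmul_eq_mul, div_mul_eq_mul_div, ← mul_div_assoc]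
      refine div_le_div_of_nonneg_right (mul_le_mul_of_nonneg_right ?_ hY0.le) hα.1.le
      exact_mod_cast Finset.card_le_univ _
  have h3 : (if ∃ i, (1 - α) / α * Y ≤ p i then (1 - α) / α * Y else 0) ≤ (1 - α) / α * Y := by
    split_ifs
    · exact le_rfl
    · positivity
  have h4 : C * Y = Fintype.card J / α * Y + (1 - α) / α * Y := add_mul _ _ _
  linarith

theorem sum_workDone_le (hinst : IsInstance r p α) (h : IsALG r p α σ) {σO : ℝ → J → ℝ}
    (hO : IsSchedule r p σO) {t x : ℝ} (hx : 0 ≤ x) :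
    ∑ j with (ncAt r p α σ t j ∧ ¬ availAt r p σO t j) ∧ workDone σ j t ≤ x, workDone σ j t
      ≤ x + 1 / (1 - α) *
        ∑ i with availAt r p σO t i ∧ truncY p α σ t i ≤ x, truncY p α σ t i := by
  have hα := hinst.alpha_mem
  have hα1 : 0 < 1 - α := sub_pos.2 hα.2
  have hβ : 0 < (1 - α) / α := div_pos hα1 hα.1
  have hev : ∀ᶠ Y in nhdsWithin x (Set.Ioi x),
      ∑ j with (ncAt r p α σ t j ∧ ¬ availAt r p σO t j) ∧ workDone σ j t ≤ x, workDone σ j t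
        ≤ Y + 1 / (1 - α) *
          ∑ i with availAt r p σO t i ∧ truncY p α σ t i ≤ x, truncY p α σ t i := by
    have hgap : ∀ᶠ Y in nhdsWithin x (Set.Ioi x), ∀ i, truncY p α σ t i ≤ Y →
        truncY p α σ t i ≤ x := by
      rw [Filter.eventually_all]
      intro i
      rcases le_or_gt (truncY p α σ t i) x with hle | hgt
      · exact Filter.Eventually.of_forall fun _ _ => hle
      · filter_upwards [nhdsWithin_le_nhds (gt_mem_nhds hgt)] with Y hY hle
        exact absurd hle (not_le.2 hY)
    filter_upwards [hgap, eventually_nhdsGT_forall_ne x fun i => α * p i, self_mem_nhdsWithin]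
      with Y hYx hYne hxY
    have hxY : x < Y := hxY
    have hmain := h.sum_deficit_le hinst hO (t := t) (hx.trans_lt hxY) hYne
    have h1 : (1 - α) / α * ∑ j with (ncAt r p α σ t j ∧ ¬ availAt r p σO t j)
          ∧ workDone σ j t ≤ x, workDone σ j t
        ≤ ∑ j with (ncAt r p α σ t j ∧ ¬ availAt r p σO t j) ∧ workDone σ j t < Y,
          (1 - α) * p j := by
      rw [Finset.mul_sum]
      refine (Finset.sum_le_sum fun j hj => ?_).trans
        (Finset.sum_le_sum_of_subset_of_nonneg (fun j hj => ?_) fun j _ _ =>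
          (mul_pos hα1 (hinst.p_pos j)).le)
      · have hnc := (Finset.mem_filter.1 hj).2.1.1.2
        rw [div_mul_eq_mul_div, div_le_iff₀ hα.1, mul_assoc]
        exact mul_le_mul_of_nonneg_left (by linarith) hα1.le
      · rw [Finset.mem_filter] at hj ⊢
        exact ⟨hj.1, hj.2.1, hj.2.2.trans_lt hxY⟩
    have h2 : (∑ i with availAt r p σO t i ∧ truncY p α σ t i ≤ Y, truncY p α σ t i / α)
        = (1 - α) / α * (1 / (1 - α) *
          ∑ i with availAt r p σO t i ∧ truncY p α σ t i ≤ x, truncY p α σ t i) := by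
      have hset : (Finset.univ.filter fun i => availAt r p σO t i ∧ truncY p α σ t i ≤ Y)
          = Finset.univ.filter fun i => availAt r p σO t i ∧ truncY p α σ t i ≤ x :=
        Finset.filter_congr fun i _ =>
          and_congr_right fun _ => ⟨hYx i, fun hle => hle.trans hxY.le⟩
      rw [hset, ← Finset.sum_div]
      field_simp
    have h3 : (if ∃ i, (1 - α) / α * Y ≤ p i then (1 - α) / α * Y else 0)
        ≤ (1 - α) / α * Y := by
      split_ifs
      · exact le_rfl
      · exact mul_nonneg hβ.le (hx.trans hxY.le)
    refine le_of_mul_le_mul_left ?_ hβ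
    rw [mul_add, ← h2]
    linarith
  refine ge_of_tendsto ?_ hev
  have : Filter.Tendsto (fun Y : ℝ => Y + 1 / (1 - α) *
      ∑ i with availAt r p σO t i ∧ truncY p α σ t i ≤ x, truncY p α σ t i) (nhds x)
      (nhds (x + 1 / (1 - α) *
        ∑ i with availAt r p σO t i ∧ truncY p α σ t i ≤ x, truncY p α σ t i)) :=
    (continuous_id.add continuous_const).tendsto x
  exact this.mono_left nhdsWithin_le_nhds

/-- If the other schedule has no available job, then neither does an ALG-schedule have a
non-clairvoyant one. -/
theorem not_ncAt_of_forall_not_availAt (hinst : IsInstance r p α) (h : IsALG r p α σ)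
    {σO : ℝ → J → ℝ} (hO : IsSchedule r p σO) {t : ℝ} (hno : ∀ i, ¬ availAt r p σO t i) (j : J) :
    ¬ ncAt r p α σ t j := by
  intro hj
  have hα := hinst.alpha_mem
  have hα1 : 0 < 1 - α := sub_pos.2 hα.2
  have hβ : 0 < (1 - α) / α := div_pos hα1 hα.1
  obtain ⟨Y, hY0, hYt, hYp, hYα⟩ : ∃ Y > 0, workDone σ j t < Y ∧
      (∀ i, p i < (1 - α) / α * Y) ∧ ∀ i, α * p i < Y := by
    have e1 : ∀ᶠ Y : ℝ in Filter.atTop, ∀ i, p i < (1 - α) / α * Y :=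
      Filter.eventually_all.2 fun i =>
        (Filter.tendsto_id.const_mul_atTop hβ).eventually_gt_atTop (p i)
    have e2 : ∀ᶠ Y : ℝ in Filter.atTop, ∀ i, α * p i < Y :=
      Filter.eventually_all.2 fun i => Filter.eventually_gt_atTop _
    exact ((Filter.eventually_gt_atTop 0).and
      ((Filter.eventually_gt_atTop _).and (e1.and e2))).exists
  have hmain := h.sum_deficit_le hinst hO (t := t) hY0 fun i => (hYα i).ne
  rw [if_neg (by push Not; exact hYp), add_zero,
    Finset.filter_false_of_mem (s := Finset.univ)
      (p := fun i => availAt r p σO t i ∧ truncY p α σ t i ≤ Y) fun i _ hi => hno i hi.1,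
    Finset.sum_empty] at hmain
  have hpos : 0 < (1 - α) * p j := mul_pos hα1 (hinst.p_pos j)
  have h1 : (1 - α) * p j ≤ ∑ j with (ncAt r p α σ t j ∧ ¬ availAt r p σO t j)
      ∧ workDone σ j t < Y, (1 - α) * p j :=
    Finset.single_le_sum (f := fun j => (1 - α) * p j)
      (fun i _ => (mul_pos hα1 (hinst.p_pos i)).le)
      (Finset.mem_filter.2 ⟨Finset.mem_univ j, ⟨hj, hno j⟩, hYt⟩)
  linarith

end IsALG

/-- For an ALG-schedule `σ` and any schedule `σO`, if
`1/(1-α)` is an integer then `|N(t) ∖ O(t)| ≤ (2 + 1/(1-α))·|O(t)|` for all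
`t ≥ 0`. -/
theorem stmt7 {J : Type*} [Fintype J] {r p : J → ℝ} {α : ℝ} {σ σO : ℝ → J → ℝ}
    (hinst : IsInstance r p α) (hint : ∃ n : ℕ, 1 / (1 - α) = (n : ℝ))
    (halg : IsALG r p α σ) (hO : IsSchedule r p σO) (t : ℝ) (ht : 0 ≤ t) :
    (({j | ncAt r p α σ t j ∧ ¬ availAt r p σO t j} : Set J).ncard : ℝ)
      ≤ (2 + 1 / (1 - α)) * (({j | availAt r p σO t j} : Set J).ncard : ℝ) := by
  obtain ⟨K, hK⟩ := hint
  let D : Finset J := Finset.univ.filter fun j => ncAt r p α σ t j ∧ ¬ availAt r p σO t j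
  let O : Finset J := Finset.univ.filter fun j => availAt r p σO t j
  have hD : ({j | ncAt r p α σ t j ∧ ¬ availAt r p σO t j} : Set J).ncard = D.card := by
    rw [← Set.ncard_coe_finset]
    simp [D]
  have hOc : ({j | availAt r p σO t j} : Set J).ncard = O.card := by
    rw [← Set.ncard_coe_finset]
    simp [O]
  rw [hD, hOc, hK]
  have hpos : ∀ j ∈ D, 0 < workDone σ j t := fun j hj => by
    obtain ⟨-, h1, h2⟩ := Finset.mem_filter.1 hj
    exact halg.workDone_pos hinst hO h1 h2
  have hcard : D.card ≤ K * O.card + 1 := by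
    refine card_le_of_sum_le D O (fun j => workDone σ j t) (truncY p α σ t) K hpos fun k hk => ?_
    have := halg.sum_workDone_le hinst hO (t := t) (hpos k hk).le
    rw [hK] at this
    simpa only [D, O, Finset.filter_filter] using this
  have hnat : D.card ≤ (2 + K) * O.card := by
    rcases O.eq_empty_or_nonempty with he | hne
    · have hno : ∀ i, ¬ availAt r p σO t i := fun i hi =>
        Finset.notMem_empty i (he ▸ Finset.mem_filter.2 ⟨Finset.mem_univ i, hi⟩)
      have : D = ∅ := Finset.filter_false_of_mem fun j _ hj =>
        halg.not_ncAt_of_forall_not_availAt hinst hO hno j hj.1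
      simp [this]
    · have := hne.card_pos
      nlinarith
  exact_mod_cast hnat
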